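/- The monodromy entries A_n and B_n satisfy the exchange relation: for all λ, μ ∈ ℂ, (λ − ωμ)·A_n(λ)B_n(μ) = ω(λ − μ)·B_n(μ)A_n(λ) + μ(1 − ω)·A_n(μ)B_n(λ) as operators on V^(n). -/

import Mathlib

open scoped BigOperators

noncomputable section

/-- The `n`-site quantum space of the Baxter–Bazhanov–Stroganov model:
functions `(Fin n → ZMod N) → ℂ`. -/
abbrev BBSV (N n : ℕ) : Type := (Fin n → ZMod N) → ℂ

/-- Weyl operator `u_k`, acting diagonally by `ω^{γ_k}` on the basis vector `|γ⟩`. -/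
def Uop (N : ℕ) (ω : ℂ) {n : ℕ} (k : Fin n) : Module.End ℂ (BBSV N n) where
  toFun f := fun γ => ω ^ (γ k).val * f γ
  map_add' f g := by funext γ; simp [mul_add]
  map_smul' r f := by
    funext γ
    simp only [Pi.smul_apply, smul_eq_mul, RingHom.id_apply]
    ring

/-- Weyl operator `u_k⁻¹`, acting diagonally by `ω^{-γ_k}` on the basis vector `|γ⟩`. -/
def Uinv (N : ℕ) (ω : ℂ) {n : ℕ} (k : Fin n) : Module.End ℂ (BBSV N n) where
  toFun f := fun γ => ω ^ (-(γ k)).val * f γ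
  map_add' f g := by funext γ; simp [mul_add]
  map_smul' r f := by
    funext γ
    simp only [Pi.smul_apply, smul_eq_mul, RingHom.id_apply]
    ring

/-- Weyl operator `v_k`, mapping `|γ⟩` to `|γ + e_k⟩`. -/
def Vop (N : ℕ) {n : ℕ} (k : Fin n) : Module.End ℂ (BBSV N n) where
  toFun f := fun γ => f (fun j => γ j - if j = k then 1 else 0)
  map_add' f g := rfl
  map_smul' r f := rfl

/-- The cyclic L-operator at site `k` with parameters `A B C D K`, a `2×2` matrix over
`End(V^(n))`. -/
def Lop (N : ℕ) (ω : ℂ) {n : ℕ} (A B C D K : ℂ) (k : Fin n) (lam : ℂ) :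
    Matrix (Fin 2) (Fin 2) (Module.End ℂ (BBSV N n)) :=
  !![1 + (lam * K) • Vop N k,
     lam • (Uinv N ω k * (A • (1 : Module.End ℂ (BBSV N n)) - B • Vop N k));
     Uop N ω k * (C • (1 : Module.End ℂ (BBSV N n)) - D • Vop N k),
     (lam * A * C) • (1 : Module.End ℂ (BBSV N n)) + (B * D / K) • Vop N k]

/-- The monodromy matrix `T_n(λ) = L_1(λ) ⋯ L_n(λ)` (sites `1,…,n` are indexed by
`0,…,n-1`, the parameters being functions on `ℕ`). -/
def Tmat (N : ℕ) (ω : ℂ) (a b c d κ : ℕ → ℂ) (n : ℕ) (lam : ℂ) :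
    Matrix (Fin 2) (Fin 2) (Module.End ℂ (BBSV N n)) :=
  ((List.finRange n).map
    (fun k => Lop N ω (a k.val) (b k.val) (c k.val) (d k.val) (κ k.val) k lam)).prod


section RLL

variable {E : Type*} [Ring E]

/-- The tensor product `X₁ Y₂` of two auxiliary-space matrices, entries of `X` on the left. -/
def auxMul (X Y : Matrix (Fin 2) (Fin 2) E) : Matrix (Fin 2 × Fin 2) (Fin 2 × Fin 2) E :=
  Matrix.of fun p q => X p.1 q.1 * Y p.2 q.2

/-- The tensor product `Y₂ X₁` of two auxiliary-space matrices, entries of `Y` on the left. -/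
def auxMulRev (X Y : Matrix (Fin 2) (Fin 2) E) : Matrix (Fin 2 × Fin 2) (Fin 2 × Fin 2) E :=
  Matrix.of fun p q => Y p.2 q.2 * X p.1 q.1

theorem auxMul_mul {X X' Y Y' : Matrix (Fin 2) (Fin 2) E}
    (h : ∀ i j k l, Commute (X' i j) (Y k l)) :
    auxMul (X * X') (Y * Y') = auxMul X Y * auxMul X' Y' := by
  have h' (i j k l) (z : E) : X' i j * (Y k l * z) = Y k l * (X' i j * z) := by
    rw [← mul_assoc, (h i j k l).eq, mul_assoc]
  ext p q
  simp only [auxMul, Matrix.of_apply, Matrix.mul_apply, Fintype.sum_prod_type,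
    Fin.sum_univ_two, mul_add, add_mul, mul_assoc, h']
  abel

theorem auxMulRev_mul {X X' Y Y' : Matrix (Fin 2) (Fin 2) E}
    (h : ∀ i j k l, Commute (Y' i j) (X k l)) :
    auxMulRev (X * X') (Y * Y') = auxMulRev X Y * auxMulRev X' Y' := by
  have h' (i j k l) (z : E) : Y' i j * (X k l * z) = X k l * (Y' i j * z) := by
    rw [← mul_assoc, (h i j k l).eq, mul_assoc]
  ext p q
  simp only [auxMulRev, Matrix.of_apply, Matrix.mul_apply, Fintype.sum_prod_type,
    Fin.sum_univ_two, mul_add, add_mul, mul_assoc, h']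

theorem commute_list_prod_apply {z : E} {l : List (Matrix (Fin 2) (Fin 2) E)}
    (h : ∀ M ∈ l, ∀ i j, Commute (M i j) z) (i j : Fin 2) : Commute (l.prod i j) z := by
  induction l generalizing i j with
  | nil =>
    rw [List.prod_nil, Matrix.one_apply]
    split_ifs
    exacts [Commute.one_left z, Commute.zero_left z]
  | cons M l ih =>
    simp only [List.mem_cons, forall_eq_or_imp] at h
    rw [List.prod_cons, Matrix.mul_apply]
    exact Commute.sum_left _ _ _ fun k _ => (h.1 i k).mul_left (ih h.2 k j)

variable [Algebra ℂ E]

/-- The twisted six-vertex `R`-matrix, with scalar entries in the algebra `E`. -/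
def sixVertexR (E : Type*) [Ring E] [Algebra ℂ E] (ω x y : ℂ) :
    Matrix (Fin 2 × Fin 2) (Fin 2 × Fin 2) E :=
  Matrix.of fun p q => algebraMap ℂ E <|
    (!![!![x - ω * y, 0; 0, 0], !![0, ω * (x - y); x * (1 - ω), 0];
       !![0, y * (1 - ω); x - y, 0], !![0, 0; 0, x - ω * y]] p.1 p.2) q.1 q.2

/-- `X` and `Y` are intertwined by the `R`-matrix: `R X₁ Y₂ = Y₂ X₁ R`. -/
def Intertwined (ω x y : ℂ) (X Y : Matrix (Fin 2) (Fin 2) E) : Prop :=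
  sixVertexR E ω x y * auxMul X Y = auxMulRev X Y * sixVertexR E ω x y

theorem Intertwined.mul {ω x y : ℂ} {X X' Y Y' : Matrix (Fin 2) (Fin 2) E}
    (h : Intertwined ω x y X Y) (h' : Intertwined ω x y X' Y')
    (hXY : ∀ i j k l, Commute (X' i j) (Y k l)) (hYX : ∀ i j k l, Commute (Y' i j) (X k l)) :
    Intertwined ω x y (X * X') (Y * Y') := by
  unfold Intertwined at *
  rw [auxMul_mul hXY, auxMulRev_mul hYX, ← mul_assoc, h, mul_assoc, h', mul_assoc]

theorem Intertwined.one (ω x y : ℂ) :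
    Intertwined ω x y (1 : Matrix (Fin 2) (Fin 2) E) 1 := by
  have h : auxMul (1 : Matrix (Fin 2) (Fin 2) E) 1 = 1 := by
    ext ⟨i, j⟩ ⟨k, l⟩
    fin_cases i <;> fin_cases j <;> fin_cases k <;> fin_cases l <;> simp [auxMul]
  have h' : auxMulRev (1 : Matrix (Fin 2) (Fin 2) E) 1 = 1 := by
    ext ⟨i, j⟩ ⟨k, l⟩
    fin_cases i <;> fin_cases j <;> fin_cases k <;> fin_cases l <;> simp [auxMulRev]
  rw [Intertwined, h, h', mul_one, one_mul]

theorem Intertwined.list_prod {ι : Type*} {ω x y : ℂ} {X Y : ι → Matrix (Fin 2) (Fin 2) E}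
    (h : ∀ s, Intertwined ω x y (X s) (Y s))
    (hXY : ∀ s t, s ≠ t → ∀ i j k l, Commute (X s i j) (Y t k l))
    {L : List ι} (hL : L.Nodup) :
    Intertwined ω x y (L.map X).prod (L.map Y).prod := by
  induction L with
  | nil => exact Intertwined.one ω x y
  | cons s L ih =>
    rw [List.nodup_cons] at hL
    have hne {t} (ht : t ∈ L) : t ≠ s := fun e => hL.1 (e ▸ ht)
    simp only [List.map_cons, List.prod_cons]
    refine (h s).mul (ih hL.2) (fun i j k l => ?_) (fun i j k l => ?_)
    · refine commute_list_prod_apply ?_ i j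
      simp only [List.mem_map, forall_exists_index, and_imp, forall_apply_eq_imp_iff₂]
      exact fun t ht i j => hXY t s (hne ht) i j k l
    · refine commute_list_prod_apply ?_ i j
      simp only [List.mem_map, forall_exists_index, and_imp, forall_apply_eq_imp_iff₂]
      exact fun t ht i j => (hXY s t (hne ht).symm k l i j).symm

theorem Intertwined.exchange_zero_zero_one {ω x y : ℂ} {X Y : Matrix (Fin 2) (Fin 2) E}
    (h : Intertwined ω x y X Y) :
    (x - ω * y) • (X 0 0 * Y 0 1) =
      (ω * (x - y)) • (Y 0 1 * X 0 0) + (y * (1 - ω)) • (Y 0 0 * X 0 1) := by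
  have := congr_fun₂ h (0, 0) (0, 1)
  simpa [sixVertexR, auxMul, auxMulRev, Matrix.mul_apply, Fintype.sum_prod_type,
    ← Algebra.commutes, ← Algebra.smul_def, -map_mul, -map_sub] using this

/-- The `L`-operator built from abstract Weyl generators `u`, `u'` and `v`. -/
def weylL (u u' v : E) (A B C D K x : ℂ) : Matrix (Fin 2) (Fin 2) E :=
  !![1 + (x * K) • v, x • (u' * (A • (1 : E) - B • v));
     u * (C • (1 : E) - D • v), (x * A * C) • (1 : E) + (B * D / K) • v]

theorem intertwined_weylL {ω : ℂ} (hω : ω ≠ 0) {u u' v : E} (huu' : u * u' = 1)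
    (hu'u : u' * u = 1) (huv : u * v = ω • (v * u)) {A B C D K : ℂ} (hK : K ≠ 0) (x y : ℂ) :
    Intertwined ω x y (weylL u u' v A B C D K x) (weylL u u' v A B C D K y) := by
  have hvu : v * u = ω⁻¹ • (u * v) := by rw [huv, smul_smul, inv_mul_cancel₀ hω, one_smul]
  have hvu' : v * u' = ω • (u' * v) := by
    calc v * u' = u' * (u * v) * u' := by rw [← mul_assoc, hu'u, one_mul]
      _ = ω • (u' * v) := by
        rw [huv, mul_smul_comm, smul_mul_assoc, mul_assoc, mul_assoc, huu', mul_one]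
  have hvu2 (z : E) : v * (u * z) = ω⁻¹ • (u * (v * z)) := by
    rw [← mul_assoc, hvu, smul_mul_assoc, mul_assoc]
  have hvu2' (z : E) : v * (u' * z) = ω • (u' * (v * z)) := by
    rw [← mul_assoc, hvu', smul_mul_assoc, mul_assoc]
  have huu2 (z : E) : u * (u' * z) = z := by rw [← mul_assoc, huu', one_mul]
  have huu2' (z : E) : u' * (u * z) = z := by rw [← mul_assoc, hu'u, one_mul]
  ext ⟨i, j⟩ ⟨k, l⟩
  fin_cases i <;> fin_cases j <;> fin_cases k <;> fin_cases l <;>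
    simp [sixVertexR, auxMul, auxMulRev, weylL, Matrix.mul_apply, Fintype.sum_prod_type,
      ← Algebra.commutes, ← Algebra.smul_def, -map_mul, -map_sub, mul_add, add_mul, mul_sub,
      sub_mul, mul_assoc, huu', hu'u, hvu, hvu', hvu2, hvu2', huu2, huu2'] <;>
    match_scalars <;> field_simp <;> ring

end RLL

section Weyl

variable {N : ℕ} {ω : ℂ} {n : ℕ}

theorem pow_val_add [NeZero N] (hω : ω ^ N = 1) (s t : ZMod N) :
    ω ^ (s + t).val = ω ^ s.val * ω ^ t.val := by
  rw [ZMod.val_add, ← pow_add, pow_eq_pow_mod (s.val + t.val) hω]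

theorem Uop_mul_Uinv [NeZero N] (hω : ω ^ N = 1) (k : Fin n) :
    Uop N ω k * Uinv N ω k = 1 := by
  refine LinearMap.ext fun f => funext fun γ => ?_
  change ω ^ (γ k).val * (ω ^ (-(γ k)).val * f γ) = f γ
  rw [← mul_assoc, ← pow_val_add hω, add_neg_cancel, ZMod.val_zero, pow_zero, one_mul]

theorem Uinv_mul_Uop [NeZero N] (hω : ω ^ N = 1) (k : Fin n) :
    Uinv N ω k * Uop N ω k = 1 := by
  refine LinearMap.ext fun f => funext fun γ => ?_
  change ω ^ (-(γ k)).val * (ω ^ (γ k).val * f γ) = f γ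
  rw [← mul_assoc, ← pow_val_add hω, neg_add_cancel, ZMod.val_zero, pow_zero, one_mul]

theorem Uop_mul_Vop (hN : 2 ≤ N) (hω : ω ^ N = 1) (k : Fin n) :
    Uop N ω k * Vop N k = ω • (Vop N k * Uop N ω k) := by
  have : NeZero N := ⟨by omega⟩
  have : Fact (1 < N) := ⟨hN⟩
  refine LinearMap.ext fun f => funext fun γ => ?_
  change ω ^ (γ k).val * f _ = ω * (ω ^ (γ k - if k = k then 1 else 0).val * f _)
  have h := pow_val_add hω (γ k - 1) 1
  rw [sub_add_cancel, ZMod.val_one, pow_one] at h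
  rw [if_pos rfl, h]
  ring

theorem commute_Vop_Vop (s t : Fin n) : Commute (Vop N s) (Vop N t) := by
  refine LinearMap.ext fun f => funext fun γ => ?_
  exact congr_arg f (funext fun j => sub_right_comm _ _ _)

theorem commute_Uop_Uop (s t : Fin n) : Commute (Uop N ω s) (Uop N ω t) := by
  refine LinearMap.ext fun f => funext fun γ => ?_
  exact mul_left_comm _ _ _

theorem commute_Uop_Uinv (s t : Fin n) : Commute (Uop N ω s) (Uinv N ω t) := by
  refine LinearMap.ext fun f => funext fun γ => ?_
  exact mul_left_comm _ _ _

theorem commute_Uinv_Uinv (s t : Fin n) : Commute (Uinv N ω s) (Uinv N ω t) := by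
  refine LinearMap.ext fun f => funext fun γ => ?_
  exact mul_left_comm _ _ _

theorem commute_Uop_Vop {s t : Fin n} (h : s ≠ t) : Commute (Uop N ω s) (Vop N t) := by
  refine LinearMap.ext fun f => funext fun γ => ?_
  change ω ^ (γ s).val * f _ = ω ^ (γ s - if s = t then 1 else 0).val * f _
  rw [if_neg h, sub_zero]

theorem commute_Uinv_Vop {s t : Fin n} (h : s ≠ t) : Commute (Uinv N ω s) (Vop N t) := by
  refine LinearMap.ext fun f => funext fun γ => ?_
  change ω ^ (-(γ s)).val * f _ = ω ^ (-(γ s - if s = t then 1 else 0)).val * f _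
  rw [if_neg h, sub_zero]

theorem commute_Lop_apply {z : Module.End ℂ (BBSV N n)} {s : Fin n}
    (hu : Commute (Uop N ω s) z) (hu' : Commute (Uinv N ω s) z) (hv : Commute (Vop N s) z)
    (A B C D K x : ℂ) (i j : Fin 2) : Commute (Lop N ω A B C D K s x i j) z := by
  have h (p q : ℂ) : Commute (p • (1 : Module.End ℂ (BBSV N n)) - q • Vop N s) z :=
    ((Commute.one_left z).smul_left p).sub_left (hv.smul_left q)
  fin_cases i <;> fin_cases j
  · exact (Commute.one_left z).add_left (hv.smul_left _)
  · exact (hu'.mul_left (h A B)).smul_left x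
  · exact hu.mul_left (h C D)
  · exact ((Commute.one_left z).smul_left _).add_left (hv.smul_left _)

theorem commute_Lop_apply_Lop_apply {s t : Fin n} (h : s ≠ t)
    (A B C D K x A' B' C' D' K' y : ℂ) (i j k l : Fin 2) :
    Commute (Lop N ω A B C D K s x i j) (Lop N ω A' B' C' D' K' t y k l) := by
  refine commute_Lop_apply ?_ ?_ ?_ _ _ _ _ _ _ i j <;> symm <;>
    refine commute_Lop_apply ?_ ?_ ?_ _ _ _ _ _ _ k l
  · exact commute_Uop_Uop t s
  · exact (commute_Uop_Uinv s t).symm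
  · exact (commute_Uop_Vop h).symm
  · exact commute_Uop_Uinv t s
  · exact commute_Uinv_Uinv t s
  · exact (commute_Uinv_Vop h).symm
  · exact commute_Uop_Vop h.symm
  · exact commute_Uinv_Vop h.symm
  · exact commute_Vop_Vop t s

end Weyl

/-- Exchange relation between the monodromy entries `A_n` and `B_n`:
`(λ − ωμ)·A_n(λ)B_n(μ) = ω(λ − μ)·B_n(μ)A_n(λ) + μ(1 − ω)·A_n(μ)B_n(λ)`. -/
theorem bbs_AB_exchange
    (N : ℕ) (hN : 2 ≤ N) (n : ℕ) (hn : 1 ≤ n)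
    (ω : ℂ) (hω : ω = Complex.exp (2 * Real.pi * Complex.I / N))
    (a b c d κ : ℕ → ℂ) (hκ : ∀ k < n, κ k ≠ 0)
    (lam mu : ℂ) :
    (lam - ω * mu) • (Tmat N ω a b c d κ n lam 0 0 * Tmat N ω a b c d κ n mu 0 1) =
      (ω * (lam - mu)) • (Tmat N ω a b c d κ n mu 0 1 * Tmat N ω a b c d κ n lam 0 0) +
        (mu * (1 - ω)) • (Tmat N ω a b c d κ n mu 0 0 * Tmat N ω a b c d κ n lam 0 1) := by
  have : NeZero N := ⟨by omega⟩
  have hroot : ω ^ N = 1 := hω ▸ (Complex.isPrimitiveRoot_exp N (NeZero.ne N)).pow_eq_one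
  have hω0 : ω ≠ 0 := hω ▸ Complex.exp_ne_zero _
  refine (Intertwined.list_prod (fun s => ?_) (fun s t hst => ?_)
    (List.nodup_finRange n)).exchange_zero_zero_one
  · exact intertwined_weylL hω0 (Uop_mul_Uinv hroot s) (Uinv_mul_Uop hroot s)
      (Uop_mul_Vop hN hroot s) (hκ s s.isLt) lam mu
  · exact commute_Lop_apply_Lop_apply hst _ _ _ _ _ _ _ _ _ _ _ _
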